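/- Let 0 → K → G → M → 0 be exact with G in the restricted G-class G̃(R) and G̃dim_R M = n > 0 finite. Then G̃dim_R K = n - 1. -/

import Mathlib

open CategoryTheory Opposite TensorProduct

universe u

namespace AB

/-- `M` is `(FP)ₙ`: there is an exact sequence `Fₙ → ⋯ → F₀ → M → 0`
with each `Fᵢ` finitely generated free.  Equivalently (the form used here),
`(FP)₀` means finitely generated, and `M` is `(FP)_{n+1}` iff there is a
surjection from a finitely generated free module whose kernel is `(FP)ₙ`. -/
def IsFP (R : Type u) [CommRing R] : ℕ → ModuleCat.{u} R → Prop
  | 0, M => Module.Finite R M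
  | n + 1, M => ∃ (k : ℕ) (f : (Fin k → R) →ₗ[R] M), Function.Surjective f ∧
      IsFP R n (ModuleCat.of R (LinearMap.ker f))

/-- `M` is `(FP)_∞`. -/
def IsFPInf (R : Type u) [CommRing R] (M : ModuleCat.{u} R) : Prop := ∀ n, IsFP R n M

/-- `Ext^i_R(M, N)` as a type. -/
noncomputable abbrev ext (R : Type u) [CommRing R] (M N : ModuleCat.{u} R) (i : ℕ) :=
  ((Ext R (ModuleCat.{u} R) i).obj (op M)).obj N

/-- `Ext^i_R(M, N) = 0`. -/
def extZero (R : Type u) [CommRing R] (M N : ModuleCat.{u} R) (i : ℕ) : Prop :=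
  Subsingleton (ext R M N i)

/-- membership in the G-class `G(R)`. -/
def MemG (R : Type u) [CommRing R] (M : ModuleCat.{u} R) : Prop :=
  Module.Finite R M ∧ Module.IsReflexive R M ∧
    (∀ i > 0, extZero R M (ModuleCat.of R R) i) ∧
    (∀ i > 0, extZero R (ModuleCat.of R (Module.Dual R M)) (ModuleCat.of R R) i)

/-- membership in the restricted G-class `G̃(R)`. -/
def MemGtilde (R : Type u) [CommRing R] (M : ModuleCat.{u} R) : Prop :=
  MemG R M ∧ IsFPInf R M ∧ IsFPInf R (ModuleCat.of R (Module.Dual R M))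

/-- `Gdim_R M ≤ n`. -/
def GDimLe (R : Type u) [CommRing R] : ℕ → ModuleCat.{u} R → Prop
  | 0, M => MemG R M
  | n + 1, M => ∃ (G : ModuleCat.{u} R) (f : G →ₗ[R] M), MemG R G ∧ Function.Surjective f ∧
      GDimLe R n (ModuleCat.of R (LinearMap.ker f))

/-- `G̃dim_R M ≤ n`. -/
def GtildeDimLe (R : Type u) [CommRing R] : ℕ → ModuleCat.{u} R → Prop
  | 0, M => MemGtilde R M
  | n + 1, M => ∃ (G : ModuleCat.{u} R) (f : G →ₗ[R] M), MemGtilde R G ∧ Function.Surjective f ∧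
      GtildeDimLe R n (ModuleCat.of R (LinearMap.ker f))

/-- `pd_R M ≤ n`. -/
def ProjDimLe (R : Type u) [CommRing R] : ℕ → ModuleCat.{u} R → Prop
  | 0, M => Module.Projective R M
  | n + 1, M => ∃ (P : ModuleCat.{u} R) (f : P →ₗ[R] M), Module.Projective R P ∧
      Function.Surjective f ∧ ProjDimLe R n (ModuleCat.of R (LinearMap.ker f))

/-- The G-dimension of `M`, as an element of `ℕ∞` (`⊤` meaning `Gdim` is infinite/undefined). -/
noncomputable def GDim (R : Type u) [CommRing R] (M : ModuleCat.{u} R) : ℕ∞ :=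
  sInf {n : ℕ∞ | ∃ m : ℕ, n = m ∧ GDimLe R m M}

/-- The restricted G-dimension of `M`, as an element of `ℕ∞`. -/
noncomputable def GtildeDim (R : Type u) [CommRing R] (M : ModuleCat.{u} R) : ℕ∞ :=
  sInf {n : ℕ∞ | ∃ m : ℕ, n = m ∧ GtildeDimLe R m M}

/-- The projective dimension of `M`, as an element of `ℕ∞`. -/
noncomputable def ProjDim (R : Type u) [CommRing R] (M : ModuleCat.{u} R) : ℕ∞ :=
  sInf {n : ℕ∞ | ∃ m : ℕ, n = m ∧ ProjDimLe R m M}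

/-- The classical depth of `N` with respect to the ideal `I`: the supremum of the
lengths of regular sequences on `N` contained in `I`. -/
noncomputable def cdepth (S : Type u) [CommRing S] (I : Ideal S) (N : Type u)
    [AddCommGroup N] [Module S N] : ℕ∞ :=
  ⨆ rs : {l : List S // (∀ r ∈ l, r ∈ I) ∧ RingTheory.Sequence.IsRegular N l},
    (rs.1.length : ℕ∞)

/-- A bundled faithfully flat (commutative) algebra extension of `R`. -/
structure FFExt (R : Type u) [CommRing R] where
  S : Type u
  [ring : CommRing S]
  [alg : Algebra R S]
  faithfullyFlat : Module.FaithfullyFlat R S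

attribute [instance] FFExt.ring FFExt.alg

/-- The depth of a module `M` over a quasi-local ring `R`: the supremum, over all
faithfully flat extensions `S` of `R`, of the classical depth of `M ⊗_R S` with
respect to `mS`. -/
noncomputable def depth (R : Type u) [CommRing R] [IsLocalRing R] (M : Type u)
    [AddCommGroup M] [Module R M] : ℕ∞ :=
  ⨆ E : FFExt R,
    cdepth E.S (Ideal.map (algebraMap R E.S) (IsLocalRing.maximalIdeal R))
      (TensorProduct R E.S M)

end AB

namespace AB

variable {R : Type u} [CommRing R]

/-- The vanishing of `Ext^i_R(M, N)` can be tested in the derived category. -/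
lemma extZero_iff (M N : ModuleCat.{u} R) {i : ℕ} (hi : 0 < i) :
    extZero R M N i ↔ Subsingleton (Abelian.Ext.{u} M N i) := by
  obtain ⟨p, rfl⟩ : ∃ p, i = p + 1 := ⟨i - 1, by omega⟩
  let P := projectiveResolution M
  have h1 : extZero R M N (p + 1) ↔ ((P.complex.linearYonedaObj R N).ExactAt (p + 1)) := by
    rw [HomologicalComplex.exactAt_iff_isZero_homology,
      ← (P.isoExt (R := R) (p + 1) N).isZero_iff]
    exact (ModuleCat.isZero_iff_subsingleton).symm
  have h2 : (P.complex.linearYonedaObj R N).ExactAt (p + 1) ↔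
      ∀ f : P.complex.X (p + 1) ⟶ N, P.complex.d (p + 2) (p + 1) ≫ f = 0 →
        ∃ g : P.complex.X p ⟶ N, P.complex.d (p + 1) p ≫ g = f := by
    rw [HomologicalComplex.exactAt_iff' _ p (p + 1) (p + 2) (by simp) (by simp),
      ShortComplex.moduleCat_exact_iff]
    rfl
  rw [h1, h2]
  constructor
  · intro h
    refine subsingleton_of_forall_eq 0 fun a => ?_
    obtain ⟨f, hf, rfl⟩ := P.extMk_surjective a (p + 2) rfl
    rw [P.extMk_eq_zero_iff f _ rfl hf p rfl]
    exact h f hf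
  · intro h f hf
    rw [← P.extMk_eq_zero_iff f _ rfl hf p rfl]
    exact Subsingleton.elim _ _

/-- A short exact sequence `0 → A → B → C → 0` of modules. -/
structure IsShortExact {A B C : Type u} [AddCommGroup A] [AddCommGroup B] [AddCommGroup C]
    [Module R A] [Module R B] [Module R C] (f : A →ₗ[R] B) (g : B →ₗ[R] C) : Prop where
  injective : Function.Injective f
  exact : Function.Exact f g
  surjective : Function.Surjective g

section

variable {A B C : Type u} [AddCommGroup A] [AddCommGroup B] [AddCommGroup C]
    [Module R A] [Module R B] [Module R C] {f : A →ₗ[R] B} {g : B →ₗ[R] C}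

namespace IsShortExact

lemma of_ker (hg : Function.Surjective g) : IsShortExact (LinearMap.ker g).subtype g where
  injective := Subtype.val_injective
  exact := LinearMap.exact_subtype_ker_map g
  surjective := hg

lemma comp_eq_zero (h : IsShortExact f g) : g ∘ₗ f = 0 := h.exact.linearMap_comp_eq_zero

/-- The associated short complex in the category of modules. -/
abbrev toShortComplex (h : IsShortExact f g) : ShortComplex (ModuleCat.{u} R) :=
  ShortComplex.mk (ModuleCat.ofHom f) (ModuleCat.ofHom g)
    (by rw [← ModuleCat.ofHom_comp, h.comp_eq_zero]; rfl)

lemma shortExact (h : IsShortExact f g) : h.toShortComplex.ShortExact where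
  exact := by
    rw [ShortComplex.moduleCat_exact_iff]
    exact fun x hx => (h.exact x).1 hx
  mono_f := (ModuleCat.mono_iff_injective _).2 h.injective
  epi_g := (ModuleCat.epi_iff_surjective _).2 h.surjective

variable {N : ModuleCat.{u} R} {i : ℕ}

lemma extZero_middle (h : IsShortExact f g) (hi : 0 < i)
    (hA : extZero R (ModuleCat.of R A) N i) (hC : extZero R (ModuleCat.of R C) N i) :
    extZero R (ModuleCat.of R B) N i := by
  rw [extZero_iff _ _ hi] at *
  refine subsingleton_of_forall_eq 0 fun x => ?_
  obtain ⟨y, rfl⟩ := Abelian.Ext.contravariant_sequence_exact₂ h.shortExact N x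
    (Subsingleton.elim _ _)
  rw [Subsingleton.elim y 0, Abelian.Ext.comp_zero]

lemma extZero_left (h : IsShortExact f g) (hi : 0 < i)
    (hB : extZero R (ModuleCat.of R B) N i) (hC : extZero R (ModuleCat.of R C) N (i + 1)) :
    extZero R (ModuleCat.of R A) N i := by
  rw [extZero_iff _ _ (by omega)] at *
  refine subsingleton_of_forall_eq 0 fun x => ?_
  obtain ⟨y, rfl⟩ := Abelian.Ext.contravariant_sequence_exact₁ h.shortExact N x
    (add_comm 1 i) (Subsingleton.elim _ _)
  rw [Subsingleton.elim y 0, Abelian.Ext.comp_zero]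

lemma extZero_right (h : IsShortExact f g) (hi : 0 < i)
    (hA : extZero R (ModuleCat.of R A) N i) (hB : extZero R (ModuleCat.of R B) N (i + 1)) :
    extZero R (ModuleCat.of R C) N (i + 1) := by
  rw [extZero_iff _ _ (by omega)] at *
  refine subsingleton_of_forall_eq 0 fun x => ?_
  obtain ⟨y, rfl⟩ := Abelian.Ext.contravariant_sequence_exact₃ h.shortExact _ x
    (Subsingleton.elim _ _) (add_comm 1 i)
  rw [Subsingleton.elim y 0, Abelian.Ext.comp_zero]

/-- `0 → C* → B* → A* → 0` is exact when `Ext^1(C, R) = 0`. -/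
lemma dual (h : IsShortExact f g)
    (hC : extZero R (ModuleCat.of R C) (ModuleCat.of R R) 1) :
    IsShortExact g.dualMap f.dualMap where
  injective := LinearMap.dualMap_injective_of_surjective h.surjective
  exact := by
    intro φ
    constructor
    · intro hφ
      have hφ' : φ ∈ LinearMap.range g.dualMap := by
        rw [LinearMap.range_dualMap_eq_dualAnnihilator_ker_of_surjective g h.surjective,
          Submodule.mem_dualAnnihilator]
        intro b hb
        obtain ⟨a, rfl⟩ := (h.exact b).1 hb
        exact LinearMap.congr_fun hφ a
      exact hφ'
    · rintro ⟨ψ, rfl⟩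
      ext a
      simp [h.exact.apply_apply_eq_zero]
  surjective := by
    intro φ
    rw [extZero_iff _ _ one_pos] at hC
    obtain ⟨y, hy⟩ := Abelian.Ext.contravariant_sequence_exact₁ h.shortExact
      (ModuleCat.of R R) (Abelian.Ext.mk₀ (ModuleCat.ofHom φ)) (add_zero 1)
      (Subsingleton.elim _ _)
    obtain ⟨ψ, rfl⟩ := Abelian.Ext.mk₀_bijective _ _ |>.2 y
    rw [Abelian.Ext.mk₀_comp_mk₀] at hy
    have := (Abelian.Ext.mk₀_bijective _ _).1 hy
    exact ⟨ψ.hom, LinearMap.ext fun a => LinearMap.congr_fun (congrArg ModuleCat.Hom.hom this) a⟩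

/-- `Ext^1(C, R) = 0` when every functional on `A` extends to `B` and `Ext^1(B, R) = 0`. -/
lemma extZero_one_of_surjective_dualMap (h : IsShortExact f g)
    (hf : Function.Surjective f.dualMap)
    (hB : extZero R (ModuleCat.of R B) (ModuleCat.of R R) 1) :
    extZero R (ModuleCat.of R C) (ModuleCat.of R R) 1 := by
  rw [extZero_iff _ _ one_pos] at *
  refine subsingleton_of_forall_eq 0 fun x => ?_
  obtain ⟨y, rfl⟩ := Abelian.Ext.contravariant_sequence_exact₃ h.shortExact _ x
    (Subsingleton.elim _ _) (add_zero 1)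
  obtain ⟨φ, rfl⟩ := Abelian.Ext.mk₀_bijective _ _ |>.2 y
  obtain ⟨ψ, hψ⟩ := hf φ.hom
  have : φ = h.toShortComplex.f ≫ ModuleCat.ofHom ψ := by
    ext a
    exact (LinearMap.congr_fun hψ a).symm
  rw [this, ← Abelian.Ext.mk₀_comp_mk₀, h.shortExact.extClass_comp_assoc]

/-- A map into `B` killed by `g` factors through `A`. -/
lemma exists_lift (h : IsShortExact f g) {X : Type u} [AddCommGroup X] [Module R X]
    (φ : X →ₗ[R] B) (hφ : ∀ x, g (φ x) = 0) : ∃ p : X →ₗ[R] A, ∀ x, f (p x) = φ x := by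
  let e : A ≃ₗ[R] LinearMap.ker g :=
    LinearEquiv.ofBijective (f.codRestrict (LinearMap.ker g) h.exact.apply_apply_eq_zero)
      ⟨fun x y hxy => h.injective (congrArg Subtype.val hxy), fun y => by
        obtain ⟨a, ha⟩ := (h.exact y).1 y.2
        exact ⟨a, Subtype.ext ha⟩⟩
  refine ⟨e.symm ∘ₗ φ.codRestrict (LinearMap.ker g) hφ, fun x => ?_⟩
  exact congrArg Subtype.val (e.apply_symm_apply (φ.codRestrict (LinearMap.ker g) hφ x))

section Constructions

variable {P Q : Type u} [AddCommGroup P] [AddCommGroup Q] [Module R P] [Module R Q]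

lemma surjective_coprod (h : IsShortExact f g) {a : P →ₗ[R] A} (ha : Function.Surjective a)
    {l : Q →ₗ[R] B} (hl : Function.Surjective (g ∘ₗ l)) :
    Function.Surjective ((f ∘ₗ a).coprod l) := by
  intro b
  obtain ⟨q, hq⟩ := hl (g b)
  obtain ⟨y, hy⟩ := (h.exact (b - l q)).1 (by simpa [sub_eq_zero] using hq.symm)
  obtain ⟨x, rfl⟩ := ha y
  exact ⟨(x, q), by simp [hy]⟩

/-- The kernels in the horseshoe lemma form a short exact sequence. -/
lemma exists_ker_coprod (h : IsShortExact f g) {a : P →ₗ[R] A} (ha : Function.Surjective a)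
    (l : Q →ₗ[R] B) :
    ∃ (i : LinearMap.ker a →ₗ[R] LinearMap.ker ((f ∘ₗ a).coprod l))
      (p : LinearMap.ker ((f ∘ₗ a).coprod l) →ₗ[R] LinearMap.ker (g ∘ₗ l)),
      IsShortExact i p := by
  refine ⟨(LinearMap.inl R P Q).restrict ?_, (LinearMap.snd R P Q).restrict ?_, ?_, ?_, ?_⟩
  · intro x hx
    simp_all
  · rintro ⟨x, q⟩ hx
    simpa [h.exact.apply_apply_eq_zero] using congrArg g hx
  · intro x y hxy
    exact Subtype.ext (congrArg (fun z => z.1.1) hxy)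
  · rintro ⟨⟨x, q⟩, hx⟩
    constructor
    · intro hq
      obtain rfl : q = 0 := (congrArg (fun z => z.1) hq)
      have hax : a x = 0 := h.injective (by simpa using hx)
      exact ⟨⟨x, hax⟩, rfl⟩
    · rintro ⟨y, hy⟩
      exact Subtype.ext (congrArg (fun z => z.1.2) hy).symm
  · rintro ⟨q, hq⟩
    obtain ⟨y, hy⟩ := (h.exact (l q)).1 hq
    obtain ⟨x, rfl⟩ := ha y
    exact ⟨⟨(-x, q), by simp [hy]⟩, rfl⟩

/-- If `φ : P → B` is surjective, the kernel of `P → C` is an extension of `A` by `ker φ`. -/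
lemma exists_ker_comp (h : IsShortExact f g) {φ : P →ₗ[R] B} (hφ : Function.Surjective φ) :
    ∃ (i : LinearMap.ker φ →ₗ[R] LinearMap.ker (g ∘ₗ φ))
      (p : LinearMap.ker (g ∘ₗ φ) →ₗ[R] A), IsShortExact i p := by
  obtain ⟨p, hp⟩ := h.exists_lift (φ ∘ₗ (LinearMap.ker (g ∘ₗ φ)).subtype) fun x => x.2
  have hle : LinearMap.ker φ ≤ LinearMap.ker (g ∘ₗ φ) := LinearMap.ker_le_ker_comp φ g
  refine ⟨Submodule.inclusion hle, p, Submodule.inclusion_injective hle, fun x => ?_, ?_⟩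
  · rw [← map_eq_zero_iff f h.injective, hp]
    exact ⟨fun hx => ⟨⟨x, hx⟩, rfl⟩, by rintro ⟨y, rfl⟩; exact y.2⟩
  · intro y
    obtain ⟨x, hx⟩ := hφ (f y)
    refine ⟨⟨x, by simp [hx, h.exact.apply_apply_eq_zero]⟩, h.injective ?_⟩
    rw [hp]
    exact hx

/-- The pullback of two surjections onto `C` is an extension of either source by the kernel of
the other surjection. -/
lemma exists_pullback (h : IsShortExact f g) {f' : P →ₗ[R] Q} {g' : Q →ₗ[R] C}
    (h' : IsShortExact f' g') :
    ∃ (X : Submodule R (B × Q)) (i : A →ₗ[R] X) (p : X →ₗ[R] Q) (i' : P →ₗ[R] X)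
      (p' : X →ₗ[R] B), IsShortExact i p ∧ IsShortExact i' p' := by
  refine ⟨LinearMap.eqLocus (g ∘ₗ LinearMap.fst R B Q) (g' ∘ₗ LinearMap.snd R B Q),
    (LinearMap.inl R B Q ∘ₗ f).codRestrict _ ?_, LinearMap.snd R B Q ∘ₗ Submodule.subtype _,
    (LinearMap.inr R B Q ∘ₗ f').codRestrict _ ?_, LinearMap.fst R B Q ∘ₗ Submodule.subtype _,
    ⟨?_, ?_, ?_⟩, ⟨?_, ?_, ?_⟩⟩
  · intro x
    simp [h.exact.apply_apply_eq_zero]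
  · intro x
    simp [h'.exact.apply_apply_eq_zero]
  · intro x y hxy
    exact h.injective (congrArg (fun z => z.1.1) hxy)
  · rintro ⟨⟨b, q⟩, hx⟩
    constructor
    · rintro (rfl : q = 0)
      obtain ⟨a, rfl⟩ := (h.exact b).1 (by simpa using hx)
      exact ⟨a, rfl⟩
    · rintro ⟨a, ha⟩
      exact (congrArg (fun z => z.1.2) ha).symm
  · intro q
    obtain ⟨b, hb⟩ := h.surjective (g' q)
    exact ⟨⟨(b, q), hb⟩, rfl⟩
  · intro x y hxy
    exact h'.injective (congrArg (fun z => z.1.2) hxy)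
  · rintro ⟨⟨b, q⟩, hx⟩
    constructor
    · rintro (rfl : b = 0)
      obtain ⟨a, rfl⟩ := (h'.exact q).1 (by simpa using hx.symm)
      exact ⟨a, rfl⟩
    · rintro ⟨a, ha⟩
      exact (congrArg (fun z => z.1.1) ha).symm
  · intro b
    obtain ⟨q, hq⟩ := h'.surjective (g b)
    exact ⟨⟨(b, q), hq.symm⟩, rfl⟩

end Constructions

end IsShortExact

end

section FP

variable {A B C : Type u} [AddCommGroup A] [AddCommGroup B] [AddCommGroup C]
    [Module R A] [Module R B] [Module R C] {f : A →ₗ[R] B} {g : B →ₗ[R] C}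

/-- `(FP)ₙ` is invariant under isomorphism. -/
lemma IsFP.of_equiv {n : ℕ} (hA : IsFP R n (ModuleCat.of R A)) (e : A ≃ₗ[R] B) :
    IsFP R n (ModuleCat.of R B) := by
  cases n with
  | zero =>
    have : Module.Finite R A := hA
    exact Module.Finite.equiv e
  | succ n =>
    obtain ⟨k, φ, hφ, hk⟩ := hA
    refine ⟨k, e.toLinearMap ∘ₗ φ, e.surjective.comp hφ, ?_⟩
    have : LinearMap.ker (e.toLinearMap ∘ₗ φ) = LinearMap.ker φ := LinearEquiv.ker_comp e φ
    rw [this]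
    exact hk

lemma IsFP.of_finite_projection {n k : ℕ} {P : Type u} [AddCommGroup P] [Module R P]
    (e : (Fin k → R) ≃ₗ[R] P) {φ : P →ₗ[R] A} (hφ : Function.Surjective φ)
    (hk : IsFP R n (ModuleCat.of R (LinearMap.ker φ))) :
    IsFP R (n + 1) (ModuleCat.of R A) := by
  refine ⟨k, φ ∘ₗ e.toLinearMap, hφ.comp e.surjective, ?_⟩
  exact hk.of_equiv (e.symm.submoduleMap (LinearMap.ker φ) ≪≫ₗ
    LinearEquiv.ofEq _ _ (by ext; simp))

lemma isFP_of_subsingleton [Subsingleton A] (n : ℕ) : IsFP R n (ModuleCat.of R A) := by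
  induction n generalizing A with
  | zero => exact inferInstanceAs (Module.Finite R A)
  | succ n ih => exact ⟨0, 0, fun x => ⟨0, Subsingleton.elim _ _⟩, ih⟩

lemma isFP_pi (n k : ℕ) : IsFP R n (ModuleCat.of R (Fin k → R)) := by
  cases n with
  | zero => exact inferInstanceAs (Module.Finite R (Fin k → R))
  | succ n =>
    refine ⟨k, LinearMap.id, Function.surjective_id, ?_⟩
    rw [LinearMap.ker_id]
    exact isFP_of_subsingleton n

namespace IsShortExact

lemma isFP_middle {n : ℕ} (h : IsShortExact f g) (hA : IsFP R n (ModuleCat.of R A))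
    (hC : IsFP R n (ModuleCat.of R C)) : IsFP R n (ModuleCat.of R B) := by
  induction n generalizing A B C with
  | zero =>
    have : Module.Finite R A := hA
    have : Module.Finite R C := hC
    exact Module.Finite.of_exact h.exact h.surjective
  | succ n ih =>
    obtain ⟨k, a, ha, hka⟩ := hA
    obtain ⟨m, c, hc, hkc⟩ := hC
    obtain ⟨l, rfl⟩ := Module.projective_lifting_property g c h.surjective
    obtain ⟨i, p, hip⟩ := h.exists_ker_coprod ha l
    exact .of_finite_projection
      (LinearEquiv.funCongrLeft R R finSumFinEquiv ≪≫ₗ LinearEquiv.sumArrowLequivProdArrow _ _ R R)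
      (h.surjective_coprod ha hc) (ih hip hka hkc)

lemma isFP_right {n : ℕ} (h : IsShortExact f g) (hA : IsFP R n (ModuleCat.of R A))
    (hB : IsFP R (n + 1) (ModuleCat.of R B)) : IsFP R (n + 1) (ModuleCat.of R C) := by
  obtain ⟨k, b, hb, hkb⟩ := hB
  obtain ⟨i, p, hip⟩ := h.exists_ker_comp hb
  exact ⟨k, g ∘ₗ b, h.surjective.comp hb, hip.isFP_middle hkb hA⟩

lemma isFP_left {n : ℕ} (h : IsShortExact f g) (hB : IsFP R n (ModuleCat.of R B))
    (hC : IsFP R (n + 1) (ModuleCat.of R C)) : IsFP R n (ModuleCat.of R A) := by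
  obtain ⟨k, c, hc, hkc⟩ := hC
  obtain ⟨X, i, p, i', p', hip, hip'⟩ := h.exists_pullback (of_ker hc)
  have hX := hip'.isFP_middle hkc hB
  obtain ⟨s, hs⟩ := Module.projective_lifting_property p LinearMap.id hip.surjective
  have hs' : ∀ x, p (s x) = x := LinearMap.congr_fun hs
  obtain ⟨q, hq⟩ := hip.exists_lift (LinearMap.id - s ∘ₗ p) (by simp [hs'])
  have hsq : IsShortExact s q := by
    refine ⟨Function.LeftInverse.injective hs', fun x => ?_, fun a => ⟨i a, hip.injective ?_⟩⟩
    · rw [← map_eq_zero_iff i hip.injective, hq]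
      constructor
      · intro hx
        exact ⟨p x, (sub_eq_zero.1 hx).symm⟩
      · rintro ⟨y, rfl⟩
        simp [hs']
    · simp [hq, hip.exact.apply_apply_eq_zero]
  cases n with
  | zero =>
    have : Module.Finite R X := hX
    exact Module.Finite.of_surjective q hsq.surjective
  | succ n => exact hsq.isFP_right (isFP_pi n k) hX

lemma isFPInf_middle (h : IsShortExact f g) (hA : IsFPInf R (ModuleCat.of R A))
    (hC : IsFPInf R (ModuleCat.of R C)) : IsFPInf R (ModuleCat.of R B) :=
  fun n => h.isFP_middle (hA n) (hC n)

lemma isFPInf_left (h : IsShortExact f g) (hB : IsFPInf R (ModuleCat.of R B))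
    (hC : IsFPInf R (ModuleCat.of R C)) : IsFPInf R (ModuleCat.of R A) :=
  fun n => h.isFP_left (hB n) (hC (n + 1))

lemma isFPInf_right (h : IsShortExact f g) (hA : IsFPInf R (ModuleCat.of R A))
    (hB : IsFPInf R (ModuleCat.of R B)) : IsFPInf R (ModuleCat.of R C)
  | 0 => by
    have : Module.Finite R B := hB 0
    exact Module.Finite.of_surjective g h.surjective
  | n + 1 => h.isFP_right (hA n) (hB (n + 1))

lemma memGtilde_left (h : IsShortExact f g) (hB : MemGtilde R (ModuleCat.of R B))
    (hC : MemGtilde R (ModuleCat.of R C)) : MemGtilde R (ModuleCat.of R A) := by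
  obtain ⟨⟨-, rB, eB, eB'⟩, fB, fB'⟩ := hB
  obtain ⟨⟨-, rC, eC, eC'⟩, fC, fC'⟩ := hC
  have hd := h.dual (eC 1 one_pos)
  have fA : IsFPInf R (ModuleCat.of R A) := h.isFPInf_left fB fC
  have hgdd : Function.Surjective g.dualMap.dualMap := by
    intro x
    obtain ⟨c, rfl⟩ := rC.bijective_dual_eval'.2 x
    obtain ⟨b, rfl⟩ := h.surjective c
    exact ⟨Module.Dual.eval R B b, rfl⟩
  have eA1 := hd.extZero_one_of_surjective_dualMap hgdd (eB' 1 one_pos)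
  have hdd := hd.dual eA1
  refine ⟨⟨fA 0, ⟨?_, ?_⟩, fun i hi => h.extZero_left hi (eB i hi) (eC _ i.succ_pos), ?_⟩,
    fA, hd.isFPInf_right fC' fB'⟩
  · intro x y hxy
    apply h.injective
    apply rB.bijective_dual_eval'.1
    exact congrArg f.dualMap.dualMap hxy
  · intro x
    obtain ⟨b, hb⟩ := rB.bijective_dual_eval'.2 (f.dualMap.dualMap x)
    have hgb : g b = 0 := by
      apply rC.bijective_dual_eval'.1
      rw [map_zero, ← hdd.exact.apply_apply_eq_zero x, ← hb]
      rfl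
    obtain ⟨a, rfl⟩ := (h.exact b).1 hgb
    exact ⟨a, hdd.injective hb⟩
  · intro i hi
    obtain rfl | ⟨j, rfl⟩ : i = 1 ∨ ∃ j, i = (j + 1) + 1 := by
      rcases i with _ | _ | j
      · omega
      · exact .inl rfl
      · exact .inr ⟨j, rfl⟩
    · exact eA1
    · exact hd.extZero_right j.succ_pos (eC' _ j.succ_pos) (eB' _ hi)

lemma memGtilde_middle (h : IsShortExact f g) (hA : MemGtilde R (ModuleCat.of R A))
    (hC : MemGtilde R (ModuleCat.of R C)) : MemGtilde R (ModuleCat.of R B) := by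
  obtain ⟨⟨-, rA, eA, eA'⟩, fA, fA'⟩ := hA
  obtain ⟨⟨-, rC, eC, eC'⟩, fC, fC'⟩ := hC
  have hd := h.dual (eC 1 one_pos)
  have hdd := hd.dual (eA' 1 one_pos)
  have fB : IsFPInf R (ModuleCat.of R B) := h.isFPInf_middle fA fC
  refine ⟨⟨fB 0, ⟨?_⟩, fun i hi => h.extZero_middle hi (eA i hi) (eC i hi),
    fun i hi => hd.extZero_middle hi (eC' i hi) (eA' i hi)⟩, fB, hd.isFPInf_middle fC' fA'⟩
  rw [Function.Bijective, injective_iff_map_eq_zero]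
  constructor
  · intro b hb
    have hgb : g b = 0 := by
      apply rC.bijective_dual_eval'.1
      rw [map_zero]
      exact (congrArg g.dualMap.dualMap hb).trans (map_zero _)
    obtain ⟨a, rfl⟩ := (h.exact b).1 hgb
    have ha : a = 0 := by
      apply rA.bijective_dual_eval'.1
      apply hdd.injective
      rw [map_zero, map_zero]
      exact hb
    rw [ha, map_zero]
  · intro x
    obtain ⟨c, hc⟩ := rC.bijective_dual_eval'.2 (g.dualMap.dualMap x)
    obtain ⟨b, rfl⟩ := h.surjective c
    obtain ⟨y, hy⟩ := (hdd.exact (x - Module.Dual.eval R B b)).1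
      (by rw [map_sub, ← hc]; exact sub_self _)
    obtain ⟨a, rfl⟩ := rA.bijective_dual_eval'.2 y
    refine ⟨f a + b, ?_⟩
    rw [map_add, ← eq_sub_iff_add_eq, ← hy]
    rfl

end IsShortExact

end FP

lemma extZero_of_projective (A : Type u) [AddCommGroup A] [Module R A] [Module.Projective R A]
    (N : ModuleCat.{u} R) {i : ℕ} (hi : 0 < i) : extZero R (ModuleCat.of R A) N i := by
  obtain ⟨j, rfl⟩ : ∃ j, i = j + 1 := ⟨i - 1, by omega⟩
  have : Projective (ModuleCat.of R A) := (IsProjective.iff_projective A).1 inferInstance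
  exact ModuleCat.isZero_iff_subsingleton.1 (isZero_Ext_succ_of_projective (R := R) _ N j)

lemma memGtilde_pi (k : ℕ) : MemGtilde R (ModuleCat.of R (Fin k → R)) := by
  refine ⟨⟨inferInstanceAs (Module.Finite R (Fin k → R)),
    inferInstanceAs (Module.IsReflexive R (Fin k → R)),
    fun i hi => extZero_of_projective _ _ hi,
    fun i hi => extZero_of_projective (Module.Dual R (Fin k → R)) _ hi⟩,
    fun n => isFP_pi n k, fun n => (isFP_pi n k).of_equiv (Pi.basisFun R (Fin k)).toDualEquiv⟩

section Dimension

variable {A B C : Type u} [AddCommGroup A] [AddCommGroup B] [AddCommGroup C]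
    [Module R A] [Module R B] [Module R C] {f : A →ₗ[R] B} {g : B →ₗ[R] C}

lemma MemGtilde.of_equiv (hA : MemGtilde R (ModuleCat.of R A)) (e : A ≃ₗ[R] B) :
    MemGtilde R (ModuleCat.of R B) := by
  have h : IsShortExact e.symm.toLinearMap (0 : A →ₗ[R] (Fin 0 → R)) :=
    ⟨e.symm.injective, fun a => ⟨fun _ => e.symm.surjective a, fun _ => rfl⟩,
      fun x => ⟨0, Subsingleton.elim _ _⟩⟩
  exact h.memGtilde_left hA (memGtilde_pi 0)

lemma GtildeDimLe.of_equiv {n : ℕ} (hA : GtildeDimLe R n (ModuleCat.of R A)) (e : A ≃ₗ[R] B) :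
    GtildeDimLe R n (ModuleCat.of R B) := by
  cases n with
  | zero => exact MemGtilde.of_equiv hA e
  | succ n =>
    obtain ⟨P, φ, hP, hφ, hk⟩ := hA
    refine ⟨P, e.toLinearMap ∘ₗ φ, hP, e.surjective.comp hφ, ?_⟩
    have : LinearMap.ker (e.toLinearMap ∘ₗ φ) = LinearMap.ker φ := LinearEquiv.ker_comp e φ
    rw [this]
    exact hk

namespace IsShortExact

lemma gtildeDimLe_right {n : ℕ} (h : IsShortExact f g)
    (hA : GtildeDimLe R n (ModuleCat.of R A)) (hB : MemGtilde R (ModuleCat.of R B)) :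
    GtildeDimLe R (n + 1) (ModuleCat.of R C) :=
  ⟨ModuleCat.of R B, g, hB, h.surjective,
    hA.of_equiv (LinearEquiv.ofInjective f h.injective ≪≫ₗ
      LinearEquiv.ofEq _ _ h.exact.linearMap_ker_eq.symm)⟩

lemma gtildeDimLe_middle {n : ℕ} (h : IsShortExact f g)
    (hA : GtildeDimLe R n (ModuleCat.of R A)) (hC : MemGtilde R (ModuleCat.of R C)) :
    GtildeDimLe R n (ModuleCat.of R B) := by
  induction n generalizing A B C with
  | zero => exact h.memGtilde_middle hA hC
  | succ n ih =>
    obtain ⟨P, a, hP, ha, hka⟩ := hA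
    obtain ⟨k, c, hc, -⟩ := hC.2.1 1
    obtain ⟨l, rfl⟩ := Module.projective_lifting_property g c h.surjective
    obtain ⟨i, p, hip⟩ := h.exists_ker_coprod ha l
    have hPQ : IsShortExact (LinearMap.inl R P (Fin k → R)) (LinearMap.snd R P (Fin k → R)) :=
      ⟨LinearMap.inl_injective, Function.Exact.inl_snd, LinearMap.snd_surjective⟩
    exact ⟨ModuleCat.of R (P × (Fin k → R)), (f ∘ₗ a).coprod l,
      hPQ.memGtilde_middle hP (memGtilde_pi k), h.surjective_coprod ha hc,
      ih hip hka ((of_ker hc).memGtilde_left (memGtilde_pi k) hC)⟩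

lemma gtildeDimLe_left_of_middle {n : ℕ} (h : IsShortExact f g)
    (hB : GtildeDimLe R n (ModuleCat.of R B)) (hC : MemGtilde R (ModuleCat.of R C)) :
    GtildeDimLe R n (ModuleCat.of R A) := by
  cases n with
  | zero => exact h.memGtilde_left hB hC
  | succ n =>
    obtain ⟨P, b, hP, hb, hkb⟩ := hB
    obtain ⟨i, p, hip⟩ := h.exists_ker_comp hb
    have hgb : Function.Surjective (g ∘ₗ b) := h.surjective.comp hb
    exact hip.gtildeDimLe_right hkb ((of_ker hgb).memGtilde_left hP hC)

/-- A syzygy with respect to any module of `G̃(R)` has smaller restricted G-dimension. -/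
lemma gtildeDimLe_left {n : ℕ} (h : IsShortExact f g) (hB : MemGtilde R (ModuleCat.of R B))
    (hC : GtildeDimLe R (n + 1) (ModuleCat.of R C)) : GtildeDimLe R n (ModuleCat.of R A) := by
  obtain ⟨P, c, hP, hc, hkc⟩ := hC
  obtain ⟨X, i, p, i', p', hip, hip'⟩ := h.exists_pullback (of_ker hc)
  exact hip.gtildeDimLe_left_of_middle (hip'.gtildeDimLe_middle hkc hB) hP

end IsShortExact

end Dimension

lemma gtildeDim_le_iff {M : ModuleCat.{u} R} {n : ℕ} :
    GtildeDim R M ≤ n ↔ ∃ m ≤ n, GtildeDimLe R m M := by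
  constructor
  · intro h
    have hne : {n : ℕ∞ | ∃ m : ℕ, n = m ∧ GtildeDimLe R m M}.Nonempty := by
      by_contra hempty
      rw [GtildeDim, Set.not_nonempty_iff_eq_empty.1 hempty, sInf_empty] at h
      exact ENat.natCast_ne_top n (top_le_iff.1 h)
    obtain ⟨m, hm, hmM⟩ := csInf_mem hne
    exact ⟨m, by rw [GtildeDim, hm] at h; exact_mod_cast h, hmM⟩
  · rintro ⟨m, hmn, hm⟩
    have hle : GtildeDim R M ≤ m := sInf_le ⟨m, rfl, hm⟩
    exact hle.trans (by exact_mod_cast hmn)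

end AB

theorem gtildeDim_kernel (R : Type u) [CommRing R] (K G M : Type u)
    [AddCommGroup K] [AddCommGroup G] [AddCommGroup M]
    [Module R K] [Module R G] [Module R M]
    (f : K →ₗ[R] G) (g : G →ₗ[R] M)
    (hf : Function.Injective f) (hg : Function.Surjective g)
    (hfg : LinearMap.range f = LinearMap.ker g)
    (hG : AB.MemGtilde R (ModuleCat.of R G)) (n : ℕ) (hn : 0 < n)
    (hM : AB.GtildeDim R (ModuleCat.of R M) = (n : ℕ∞)) :
    AB.GtildeDim R (ModuleCat.of R K) = ((n - 1 : ℕ) : ℕ∞) := by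
  have h : AB.IsShortExact f g := ⟨hf, LinearMap.exact_iff.2 hfg.symm, hg⟩
  obtain ⟨p, rfl⟩ : ∃ p, n = p + 1 := ⟨n - 1, by omega⟩
  rw [Nat.add_sub_cancel]
  have lower : ∀ m : ℕ, AB.GtildeDimLe R m (ModuleCat.of R M) → p + 1 ≤ m := fun m hm => by
    have := AB.gtildeDim_le_iff.2 ⟨m, le_rfl, hm⟩
    rw [hM] at this
    exact_mod_cast this
  apply le_antisymm
  · obtain ⟨m, hm, hmM⟩ := AB.gtildeDim_le_iff.1 hM.le
    obtain rfl := hm.antisymm (lower m hmM)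
    exact AB.gtildeDim_le_iff.2 ⟨p, le_rfl, h.gtildeDimLe_left hG hmM⟩
  · refine le_sInf ?_
    rintro _ ⟨m, rfl, hm⟩
    exact_mod_cast Nat.le_of_succ_le_succ (lower (m + 1) (h.gtildeDimLe_right hm hG))
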